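/- arXiv:2403.01951 — 4 statements merged into one kernel-verified Lean document; each statement's English description precedes it below -/
import Mathlib

section
/- Let R be a commutative ring and let b ∈ R. Suppose the polynomial ring R[X] is adically complete with respect to the ideal generated by b, i.e. (separatedness) ⋂ₙ bⁿ·R[X] = 0, and (completeness) every sequence of polynomials (fₙ)ₙ with fₙ₊₁ − fₙ ∈ bⁿ·R[X] for all n admits a limit f ∈ R[X] with f − fₙ ∈ bⁿ·R[X] for all n. Then b is nilpotent. -/
/-- If the polynomial ring `R[X]` is adically complete with respect to the ideal
generated by an element `b ∈ R`, then `b` is nilpotent. -/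
theorem polynomial_isAdicComplete_span_singleton_isNilpotent
    {R : Type*} [CommRing R] (b : R)
    (h : IsAdicComplete (Ideal.span {Polynomial.C b}) (Polynomial R)) :
    IsNilpotent b := by
  have hb : Polynomial.C b ∈ (⊥ : Ideal (Polynomial R)).jacobson :=
    IsAdicComplete.le_jacobson_bot _ (Ideal.mem_span_singleton_self _)
  have hu : IsUnit (Polynomial.C b * Polynomial.X + 1) :=
    Ideal.mem_jacobson_bot.mp hb Polynomial.X
  simpa [Polynomial.coeff_one] using
    (Polynomial.isUnit_iff_coeff_isUnit_isNilpotent.mp hu).2 1 one_ne_zero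
end

section
/- Let R be a commutative ring and let J ⊆ R be a finitely generated ideal. Suppose the polynomial ring R[X] is adically complete with respect to the ideal J·R[X] generated by J, i.e. ⋂ₙ Jⁿ·R[X] = 0 and every sequence of polynomials (fₙ)ₙ with fₙ₊₁ − fₙ ∈ Jⁿ·R[X] for all n admits a limit f ∈ R[X] with f − fₙ ∈ Jⁿ·R[X] for all n. Then J is nilpotent, i.e. there exists n ≥ 1 with Jⁿ = 0. -/
open Polynomial in
theorem Polynomial.smodEq_map_C_pow_smul_top_iff {R : Type*} [CommRing R] {J : Ideal R} {n : ℕ}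
    {p q : R[X]} :
    p ≡ q [SMOD ((J.map (C : R →+* R[X])) ^ n • ⊤ : Submodule R[X] R[X])] ↔
      ∀ k, p.coeff k - q.coeff k ∈ J ^ n := by
  rw [SModEq.sub_mem, smul_eq_mul, Ideal.mul_top, ← Ideal.map_pow, Ideal.mem_map_C_iff]
  simp only [coeff_sub]

open Polynomial in
theorem Polynomial.eq_zero_of_forall_mem_pow_of_isHausdorff_map_C {R : Type*} [CommRing R]
    {J : Ideal R} (h : IsHausdorff (J.map (C : R →+* R[X])) R[X]) {r : R}
    (hr : ∀ n, r ∈ J ^ n) : r = 0 := by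
  rw [← C_eq_zero]
  refine h.haus _ fun n => smodEq_map_C_pow_smul_top_iff.2 fun k => ?_
  rw [coeff_C, coeff_zero, sub_zero]
  split_ifs
  exacts [hr n, zero_mem _]

open Polynomial in
/-- The geometric series `∑ aᵏ Xᵏ` converges in `R[X]`, so it has only finitely many nonzero
coefficients. -/
theorem Polynomial.isNilpotent_of_mem_of_isAdicComplete_map_C {R : Type*} [CommRing R]
    {J : Ideal R} (h : IsAdicComplete (J.map (C : R →+* R[X])) R[X]) {a : R} (ha : a ∈ J) :
    IsNilpotent a := by
  let f : ℕ → R[X] := fun n => ∑ i ∈ Finset.range n, monomial i (a ^ i)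
  have hf (n k : ℕ) : (f n).coeff k = if k < n then a ^ k else 0 := by
    simp [f, coeff_monomial]
  obtain ⟨L, hL⟩ := h.toIsPrecomplete.prec (f := f) fun {m n} hmn => by
    refine smodEq_map_C_pow_smul_top_iff.2 fun k => ?_
    rw [hf, hf]
    by_cases hkm : k < m
    · simp [hkm, hkm.trans_le hmn]
    · have hk : a ^ k ∈ J ^ m := Ideal.pow_le_pow_right (not_lt.1 hkm) (Ideal.pow_mem_pow ha k)
      split_ifs
      · simpa using hk
      · simp
  have hcoeff (k : ℕ) : a ^ k = L.coeff k := by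
    rw [← sub_eq_zero]
    refine eq_zero_of_forall_mem_pow_of_isHausdorff_map_C h.toIsHausdorff fun n => ?_
    have hk := smodEq_map_C_pow_smul_top_iff.1 (hL (n + k + 1)) k
    rw [hf, if_pos (by omega)] at hk
    exact Ideal.pow_le_pow_right (by omega) hk
  exact ⟨L.natDegree + 1, by rw [hcoeff, coeff_eq_zero_of_natDegree_lt (Nat.lt_succ_self _)]⟩

/-- If `J ⊆ R` is a finitely generated ideal such that the polynomial ring `R[X]`
is adically complete with respect to the ideal `J·R[X]` generated by `J`, then
`J` is nilpotent: `Jⁿ = 0` for some `n ≥ 1`. -/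
theorem polynomial_isAdicComplete_map_isNilpotent
    {R : Type*} [CommRing R] (J : Ideal R) (hJ : J.FG)
    (h : IsAdicComplete (J.map (Polynomial.C : R →+* Polynomial R)) (Polynomial R)) :
    ∃ n : ℕ, 1 ≤ n ∧ J ^ n = ⊥ := by
  obtain ⟨n, hn⟩ := hJ.isNilpotent_iff_le_nilradical.2 fun a ha =>
    Polynomial.isNilpotent_of_mem_of_isAdicComplete_map_C h ha
  exact ⟨n + 1, Nat.le_add_left 1 n, by rw [pow_succ, hn, zero_mul, Ideal.zero_eq_bot]⟩
end

section
/- Let A be a commutative ring and let I ⊆ A be an ideal satisfying: (a) I is the union of a family of principal ideals (a_t), t ∈ T, which is directed under inclusion, where each a_t is a non-zero-divisor of A; and (b) I·I = I. Then the multiplication map I ⊗_A I → I, x ⊗ y ↦ x·y, is an isomorphism of A-modules. -/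
/-- If an ideal is a directed union of principal ideals `(a t)`, every element of `I ⊗[A] M`
is a pure tensor whose first factor is one of the generators `a t`. -/
theorem Ideal.exists_tmul_eq_of_directed_union {A : Type*} [CommRing A] (I : Ideal A)
    {M : Type*} [AddCommGroup M] [Module A M] {T : Type*} (a : T → A)
    (hdir : Directed (· ≤ ·) fun t => Ideal.span {a t})
    (hunion : (I : Set A) = ⋃ t, (Ideal.span {a t} : Set A)) (z : TensorProduct A I M) :
    ∃ (t : T) (h : a t ∈ I) (m : M), z = TensorProduct.tmul A (⟨a t, h⟩ : I) m := by
  have exists_span {x : A} (hx : x ∈ I) : ∃ t, x ∈ Ideal.span {a t} := by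
    rw [← SetLike.mem_coe, hunion] at hx
    simpa using hx
  have mem (t : T) : a t ∈ I := by
    rw [← SetLike.mem_coe, hunion]
    exact Set.mem_iUnion.2 ⟨t, Ideal.mem_span_singleton_self _⟩
  have tmul_eq {x : A} (hx : x ∈ I) {t : T} (hxt : x ∈ Ideal.span {a t}) (m : M) :
      ∃ m', TensorProduct.tmul A (⟨x, hx⟩ : I) m =
        TensorProduct.tmul A (⟨a t, mem t⟩ : I) m' := by
    obtain ⟨c, rfl⟩ := Ideal.mem_span_singleton'.1 hxt
    exact ⟨c • m, TensorProduct.smul_tmul c (⟨a t, mem t⟩ : I) m⟩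
  induction z with
  | zero =>
    obtain ⟨t, -⟩ := exists_span I.zero_mem
    exact ⟨t, mem t, 0, (TensorProduct.tmul_zero _ _).symm⟩
  | tmul x m =>
    obtain ⟨t, ht⟩ := exists_span x.2
    obtain ⟨m', hm'⟩ := tmul_eq x.2 ht m
    exact ⟨t, mem t, m', hm'⟩
  | add z w hz hw =>
    obtain ⟨s, hs, m, rfl⟩ := hz
    obtain ⟨t, ht, n, rfl⟩ := hw
    obtain ⟨r, hsr, htr⟩ := hdir s t
    obtain ⟨m', hm'⟩ := tmul_eq hs (hsr (Ideal.mem_span_singleton_self _)) m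
    obtain ⟨n', hn'⟩ := tmul_eq ht (htr (Ideal.mem_span_singleton_self _)) n
    exact ⟨r, mem r, m' + n', by rw [hm', hn', TensorProduct.tmul_add]⟩

/-- Let `I` be an ideal of a commutative ring `A` which is the union of a family of
principal ideals `(a t)`, directed under inclusion, with each `a t` a non-zero-divisor,
and which satisfies `I * I = I`.  Then the multiplication map `I ⊗[A] I → I`,
`x ⊗ y ↦ x * y`, is an isomorphism of `A`-modules. -/
theorem mulMap_bijective_of_directed_union_of_idempotent
    {A : Type*} [CommRing A] (I : Ideal A) {T : Type*}
    (a : T → A) (ha : ∀ t, a t ∈ nonZeroDivisors A)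
    (hdir : Directed (· ≤ ·) fun t => Ideal.span {a t})
    (hunion : (I : Set A) = ⋃ t, (Ideal.span {a t} : Set A))
    (hidem : I * I = I) :
    Function.Bijective
      ((LinearEquiv.ofEq (I * I) I hidem).toLinearMap ∘ₗ Submodule.mulMap' I I) := by
  rw [LinearMap.coe_comp]
  refine (LinearEquiv.ofEq (I * I) I hidem).bijective.comp
    ⟨(injective_iff_map_eq_zero _).2 fun z hz => ?_, Submodule.mulMap'_surjective I I⟩
  obtain ⟨t, ht, y, rfl⟩ := I.exists_tmul_eq_of_directed_union a hdir hunion z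
  have hy : a t * (y : A) = 0 := congrArg Subtype.val hz
  have : y = 0 := Subtype.ext ((mul_left_mem_nonZeroDivisors_eq_zero_iff (ha t)).1 hy)
  rw [this, TensorProduct.tmul_zero]
end

section
/- Let A be a commutative ring and let I ⊆ A be an ideal satisfying: (a) I is the union of a family of principal ideals (a_t), t ∈ T, which is directed under inclusion, where each a_t is a non-zero-divisor of A; and (b) I·I = I. Then I is a flat A-module and Tor_n^A(A/I, A/I) = 0 for all n ≥ 1; in particular the quotient A/I is idempotent over A in the derived sense, i.e. the natural map A/I ⊗_A^L A/I → A/I is an isomorphism. -/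
open CategoryTheory

universe u

section DirectedUnion

variable {A : Type*} [CommRing A] {I : Ideal A} {T : Type*} {a : T → A}

lemma Ideal.mem_of_eq_iUnion_span_singleton
    (hunion : (I : Set A) = ⋃ t, (Ideal.span {a t} : Set A)) (t : T) : a t ∈ I := by
  rw [← SetLike.mem_coe, hunion]
  exact Set.mem_iUnion.2 ⟨t, Ideal.mem_span_singleton_self _⟩

lemma Ideal.exists_dvd_of_mem_of_eq_iUnion_span_singleton
    (hunion : (I : Set A) = ⋃ t, (Ideal.span {a t} : Set A)) {x : A} (hx : x ∈ I) :
    ∃ t, a t ∣ x := by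
  rw [← SetLike.mem_coe, hunion] at hx
  obtain ⟨t, ht⟩ := Set.mem_iUnion.1 hx
  exact ⟨t, Ideal.mem_span_singleton.1 ht⟩

/-- If `I` is a directed union of principal ideals `(a t)`, then every element of `I • N` is of
the form `a t • y` with `y ∈ N`. -/
lemma Submodule.exists_eq_smul_of_mem_smul_of_directed {M : Type*} [AddCommGroup M] [Module A M]
    (hdir : Directed (· ≤ ·) fun t => Ideal.span {a t})
    (hunion : (I : Set A) = ⋃ t, (Ideal.span {a t} : Set A))
    {N : Submodule A M} {x : M} (hx : x ∈ I • N) :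
    ∃ t, ∃ y ∈ N, x = a t • y := by
  refine Submodule.smul_induction_on hx (fun r hr n hn => ?_) ?_
  · obtain ⟨t, c, rfl⟩ := Ideal.exists_dvd_of_mem_of_eq_iUnion_span_singleton hunion hr
    exact ⟨t, c • n, N.smul_mem c hn, mul_smul _ _ _⟩
  · rintro _ _ ⟨s, x, hxN, rfl⟩ ⟨t, y, hyN, rfl⟩
    obtain ⟨r, hs, ht⟩ := hdir s t
    obtain ⟨c, hc⟩ := Ideal.span_singleton_le_span_singleton.1 hs
    obtain ⟨d, hd⟩ := Ideal.span_singleton_le_span_singleton.1 ht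
    exact ⟨r, c • x + d • y, N.add_mem (N.smul_mem c hxN) (N.smul_mem d hyN),
      by rw [hc, hd, smul_add, mul_smul, mul_smul]⟩

/-- A directed union of principal ideals generated by non-zero-divisors is flat. -/
theorem Ideal.flat_of_directed_union_span_singleton
    (ha : ∀ t, a t ∈ nonZeroDivisors A)
    (hdir : Directed (· ≤ ·) fun t => Ideal.span {a t})
    (hunion : (I : Set A) = ⋃ t, (Ideal.span {a t} : Set A)) : Module.Flat A I := by
  refine Module.Flat.of_forall_isTrivialRelation fun {l f x} h => ?_
  choose τ hτ using fun i =>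
    Ideal.exists_dvd_of_mem_of_eq_iUnion_span_singleton hunion (x i).2
  obtain ⟨t₀, -⟩ := Ideal.exists_dvd_of_mem_of_eq_iUnion_span_singleton hunion I.zero_mem
  have : Nonempty T := ⟨t₀⟩
  obtain ⟨t, ht⟩ := hdir.finite_le τ
  choose c hc using fun i => (Ideal.span_singleton_le_span_singleton.1 (ht i)).trans (hτ i)
  refine ⟨1, fun i _ => c i, fun _ => ⟨a t, Ideal.mem_of_eq_iUnion_span_singleton hunion t⟩,
    fun i => ?_, fun _ => ?_⟩
  · ext
    simp [hc, mul_comm]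
  · refine (mul_right_mem_nonZeroDivisors_eq_zero_iff (ha t)).1 ?_
    have h' := congrArg Subtype.val h
    simp only [AddSubmonoidClass.coe_finsetSum, Submodule.coe_smul, hc, smul_eq_mul,
      ZeroMemClass.coe_zero] at h'
    rw [Finset.sum_mul, ← h']
    exact Finset.sum_congr rfl fun i _ => by ring

end DirectedUnion

lemma Ideal.one_tmul_eq_zero_iff {A M : Type*} [CommRing A] [AddCommGroup M] [Module A M]
    (I : Ideal A) (x : M) :
    TensorProduct.tmul A (1 : A ⧸ I) x = 0 ↔ x ∈ I • (⊤ : Submodule A M) := by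
  rw [← (TensorProduct.quotTensorEquivQuotSMul M I).map_eq_zero_iff,
    TensorProduct.quotTensorEquivQuotSMul_mk_one_tmul, Submodule.Quotient.mk_eq_zero]

/-- Tensoring an exact pair with `A ⧸ I` stays exact as soon as every element of
`range g ⊓ I • ⊤` is the image of an element of `I • ⊤`. -/
lemma Ideal.exact_lTensor_quotient {A M N P : Type*} [CommRing A] [AddCommGroup M]
    [AddCommGroup N] [AddCommGroup P] [Module A M] [Module A N] [Module A P] (I : Ideal A)
    {f : M →ₗ[A] N} {g : N →ₗ[A] P} (h : Function.Exact f g)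
    (H : ∀ x, g x ∈ I • (⊤ : Submodule A P) → ∃ z ∈ I • (⊤ : Submodule A N), g x = g z) :
    Function.Exact (f.lTensor (A ⧸ I)) (g.lTensor (A ⧸ I)) := by
  intro x
  constructor
  · obtain ⟨x, rfl⟩ : ∃ y : N, TensorProduct.tmul A (1 : A ⧸ I) y = x :=
      TensorProduct.mk_surjective A N (A ⧸ I) Ideal.Quotient.mk_surjective x
    intro hx
    rw [LinearMap.lTensor_tmul, Ideal.one_tmul_eq_zero_iff] at hx
    obtain ⟨z, hz, hxz⟩ := H x hx
    obtain ⟨y, hy⟩ := (h (x - z)).1 (by rw [map_sub, hxz, sub_self])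
    refine ⟨TensorProduct.tmul A 1 y, ?_⟩
    rw [LinearMap.lTensor_tmul, hy, TensorProduct.tmul_sub, (I.one_tmul_eq_zero_iff z).2 hz, sub_zero]
  · rintro ⟨y, rfl⟩
    rw [← LinearMap.comp_apply, ← LinearMap.lTensor_comp, h.linearMap_comp_eq_zero]
    simp

/-- Let `I` be an ideal of a commutative ring `A` which is the union of a family of
principal ideals `(a t)`, directed under inclusion, with each `a t` a non-zero-divisor,
and which satisfies `I * I = I`.  Then `I` is a flat `A`-module and
`Tor_n^A(A/I, A/I) = 0` for all `n ≥ 1` (so that `A/I` is idempotent over `A`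
in the derived sense). -/
theorem flat_and_tor_vanishing_of_directed_union_of_idempotent
    {A : Type u} [CommRing A] (I : Ideal A) {T : Type*}
    (a : T → A) (ha : ∀ t, a t ∈ nonZeroDivisors A)
    (hdir : Directed (· ≤ ·) fun t => Ideal.span {a t})
    (hunion : (I : Set A) = ⋃ t, (Ideal.span {a t} : Set A))
    (hidem : I * I = I) :
    Module.Flat A I ∧
      ∀ n : ℕ, 1 ≤ n →
        Limits.IsZero (((Tor (ModuleCat.{u} A) n).obj
          (ModuleCat.of A (A ⧸ I))).obj (ModuleCat.of A (A ⧸ I))) := by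
  refine ⟨Ideal.flat_of_directed_union_span_singleton ha hdir hunion, fun n hn => ?_⟩
  obtain ⟨n, rfl⟩ := Nat.exists_eq_add_of_le' hn
  let P := projectiveResolution (ModuleCat.of A (A ⧸ I))
  let F := (MonoidalCategory.tensoringLeft (ModuleCat.{u} A)).obj (ModuleCat.of A (A ⧸ I))
  refine Limits.IsZero.of_iso ?_ (P.isoLeftDerivedObj F (n + 1))
  refine (HomologicalComplex.exactAt_iff_isZero_homology _ _).1 ?_
  rw [HomologicalComplex.exactAt_iff' _ (n + 2) (n + 1) n (by simp) (by simp)]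
  refine (ShortComplex.ShortExact.moduleCat_exact_iff_function_exact _).2 ?_
  have hex := (ShortComplex.ShortExact.moduleCat_exact_iff_function_exact _).1 (P.exact_succ n)
  refine Ideal.exact_lTensor_quotient I hex fun x hx => ?_
  change P.complex.X (n + 1) at x
  change ∃ z ∈ I • (⊤ : Submodule A (P.complex.X (n + 1))),
    (P.complex.d (n + 1) n).hom x = (P.complex.d (n + 1) n).hom z
  change (P.complex.d (n + 1) n).hom x ∈ I • (⊤ : Submodule A (P.complex.X n)) at hx
  suffices ∃ s, ∃ w z, (P.complex.d (n + 1) n).hom x = a s • w ∧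
      (P.complex.d (n + 1) n).hom z = w by
    obtain ⟨s, w, z, h₁, h₂⟩ := this
    exact ⟨a s • z, Submodule.smul_mem_smul
      (Ideal.mem_of_eq_iUnion_span_singleton hunion s) trivial, by rw [h₁, map_smul, h₂]⟩
  obtain _ | n := n
  · have hsq : I • (⊤ : Submodule A (P.complex.X 0)) = I • I • ⊤ := by
      rw [← Submodule.smul_assoc, smul_eq_mul, hidem]
    rw [hsq] at hx
    obtain ⟨s, w, hw, hxw⟩ := Submodule.exists_eq_smul_of_mem_smul_of_directed hdir hunion hx
    have hex₀ : (ShortComplex.mk _ _ P.complex_d_comp_π_f_zero).Exact :=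
      ShortComplex.exact_of_g_is_cokernel _ P.isColimitCokernelCofork
    obtain ⟨z, hz⟩ := (ShortComplex.moduleCat_exact_iff _).1 hex₀ w (by
      refine Submodule.smul_induction_on hw (fun c hc y _ => ?_) fun y z hy hz => ?_
      · refine (map_smul (P.π.f 0).hom c y).trans ?_
        obtain ⟨q, hq⟩ := Ideal.Quotient.mk_surjective (I := I) ((P.π.f 0).hom y)
        erw [← hq]
        exact Ideal.Quotient.eq_zero_iff_mem.2 (I.mul_mem_right q hc)
      · rw [map_add, hy, hz, add_zero])
    exact ⟨s, w, z, hxw, hz⟩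
  · obtain ⟨s, w, -, hxw⟩ := Submodule.exists_eq_smul_of_mem_smul_of_directed hdir hunion hx
    have : Module.Projective A (P.complex.X n) :=
      (IsProjective.iff_projective _).2 (P.projective n)
    obtain ⟨z, hz⟩ := (ShortComplex.moduleCat_exact_iff _).1 (P.exact_succ n) w (by
      refine Module.Flat.isSMulRegular_of_nonZeroDivisors (ha s) ?_
      change a s • (P.complex.d (n + 1) n).hom w = a s • 0
      rw [← map_smul, ← hxw, smul_zero]
      exact ConcreteCategory.congr_hom (P.complex.d_comp_d (n + 2) (n + 1) n) x)
    exact ⟨s, w, z, hxw, hz⟩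
end
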